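/- (Proposition 2, second statement, deterministic sample-path version) If (W^c, u) optimally solves problem (10), then (W^c, W^L, u) optimally solves problem (7). -/

import Mathlib

open Filter Finset

noncomputable section

/-- `{0,1}`-valued real indicator of a proposition. -/
def ind (P : Prop) [Decidable P] : ℝ := if P then 1 else 0

/-- Positive part `[x]^+ = max(x,0)`. -/
def pos (x : ℝ) : ℝ := max x 0

/-- A scheduler takes values in `{0,1}`. -/
def IsScheduler {N : ℕ} (u : ℕ → Fin N → ℝ) : Prop :=
  ∀ t i, u t i = 0 ∨ u t i = 1

/-- Feasibility of the triple `(Wc, Wr, u)` for problem (7). -/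
def Feasible7 {N : ℕ} (W : ℕ → Fin N → ℝ) (PH : Fin N → ℝ) (F : Fin N → ℝ → ℝ)
    (WL : Fin N → ℝ) (Wc : ℝ) (Wr : Fin N → ℝ) (u : ℕ → Fin N → ℝ) : Prop :=
  (∀ i, PH i - F i (Wr i) ≤
      Filter.liminf (fun T : ℕ =>
        (1 / (T : ℝ)) * ∑ t ∈ Finset.Icc 1 T, u t i * ind (Wr i < W t i)) Filter.atTop) ∧
  (∀ i, WL i ≤ Wr i) ∧
  (∀ t, ∑ i, u t i * pos (W t i - Wr i) ≤ Wc + ∑ i, pos (Wr i - W t i)) ∧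
  IsScheduler u

/-- Objective value of problem (7). -/
def objective7 {N : ℕ} (Wc : ℝ) (Wr : Fin N → ℝ) : ℝ := Wc + ∑ i, Wr i

/-- Optimality of the triple `(Wc, Wr, u)` for problem (7). -/
def Optimal7 {N : ℕ} (W : ℕ → Fin N → ℝ) (PH : Fin N → ℝ) (F : Fin N → ℝ → ℝ)
    (WL : Fin N → ℝ) (Wc : ℝ) (Wr : Fin N → ℝ) (u : ℕ → Fin N → ℝ) : Prop :=
  Feasible7 W PH F WL Wc Wr u ∧
  ∀ (Wc' : ℝ) (Wr' : Fin N → ℝ) (u' : ℕ → Fin N → ℝ),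
    Feasible7 W PH F WL Wc' Wr' u' → objective7 Wc Wr ≤ objective7 Wc' Wr'

/-- Feasibility of the pair `(Wc, u)` for problem (10), where `P^M_i = F_i(W_i^L)`. -/
def Feasible10 {N : ℕ} (W : ℕ → Fin N → ℝ) (PH : Fin N → ℝ) (F : Fin N → ℝ → ℝ)
    (WL : Fin N → ℝ) (Wc : ℝ) (u : ℕ → Fin N → ℝ) : Prop :=
  (∀ i, PH i - F i (WL i) ≤
      Filter.liminf (fun T : ℕ =>
        (1 / (T : ℝ)) * ∑ t ∈ Finset.Icc 1 T, u t i * ind (WL i < W t i)) Filter.atTop) ∧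
  (∀ t, ∑ i, u t i * pos (W t i - WL i) ≤ Wc + ∑ i, pos (WL i - W t i)) ∧
  IsScheduler u

/-- Optimality of the pair `(Wc, u)` for problem (10); the objective is `Wc`. -/
def Optimal10 {N : ℕ} (W : ℕ → Fin N → ℝ) (PH : Fin N → ℝ) (F : Fin N → ℝ → ℝ)
    (WL : Fin N → ℝ) (Wc : ℝ) (u : ℕ → Fin N → ℝ) : Prop :=
  Feasible10 W PH F WL Wc u ∧
  ∀ (Wc' : ℝ) (u' : ℕ → Fin N → ℝ), Feasible10 W PH F WL Wc' u' → Wc ≤ Wc'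

/-- The time averages of a `[0, 1]`-valued sequence lie in `[0, 1]`. -/
theorem average_mem_Icc {a : ℕ → ℝ} (ha : ∀ t, a t ∈ Set.Icc (0 : ℝ) 1) (T : ℕ) :
    (1 / (T : ℝ)) * ∑ t ∈ Finset.Icc 1 T, a t ∈ Set.Icc (0 : ℝ) 1 := by
  have hsum : ∑ t ∈ Finset.Icc 1 T, a t ≤ T := by
    simpa using Finset.sum_le_card_nsmul (Finset.Icc 1 T) a 1 fun t _ => (ha t).2
  refine ⟨mul_nonneg (by positivity) (Finset.sum_nonneg fun t _ => (ha t).1), ?_⟩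
  rw [one_div_mul_eq_div]
  exact div_le_one_of_le₀ hsum (Nat.cast_nonneg T)

/-- Adding a convergent sequence to a bounded one shifts the liminf by at least the limit. -/
theorem liminf_add_le_liminf_add_of_tendsto {f h : ℕ → ℝ} {l a b : ℝ}
    (hf : ∀ n, f n ∈ Set.Icc a b) (hh : Tendsto h atTop (nhds l)) :
    liminf f atTop + l ≤ liminf (f + h) atTop := by
  rw [← hh.liminf_eq]
  exact le_liminf_add (isBoundedUnder_of ⟨a, fun n => (hf n).1⟩)
    (isBoundedUnder_of ⟨b, fun n => (hf n).2⟩) hh.isBoundedUnder_ge hh.isCoboundedUnder_ge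

/-- The scheduler that serves every demand up to the reservation `Wr`, and follows `u` above it. -/
def servedUpTo {N : ℕ} (W : ℕ → Fin N → ℝ) (Wr : Fin N → ℝ) (u : ℕ → Fin N → ℝ) :
    ℕ → Fin N → ℝ :=
  fun t i => if W t i ≤ Wr i then 1 else u t i

theorem servedUpTo_mul_ind {N : ℕ} (W : ℕ → Fin N → ℝ) {WL Wr : Fin N → ℝ}
    (u : ℕ → Fin N → ℝ) (t : ℕ) {i : Fin N} (hi : WL i ≤ Wr i) :
    servedUpTo W Wr u t i * ind (WL i < W t i) =
      u t i * ind (Wr i < W t i) + (ind (W t i ≤ Wr i) - ind (W t i ≤ WL i)) := by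
  simp only [servedUpTo, ind]
  grind

theorem servedUpTo_mul_pos_le {N : ℕ} (W : ℕ → Fin N → ℝ) {WL Wr : Fin N → ℝ}
    {u : ℕ → Fin N → ℝ} {t : ℕ} {i : Fin N} (hu : u t i ≤ 1) (hi : WL i ≤ Wr i) :
    servedUpTo W Wr u t i * pos (W t i - WL i) - pos (WL i - W t i) ≤
      u t i * pos (W t i - Wr i) - pos (Wr i - W t i) + (Wr i - WL i) := by
  unfold servedUpTo pos
  split_ifs with h
  · rw [max_eq_right (sub_nonpos.2 h), max_eq_left (sub_nonneg.2 h)]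
    grind
  · rw [max_eq_left (by linarith), max_eq_right (by linarith), max_eq_left (by linarith),
      max_eq_right (by linarith)]
    nlinarith

/-- Lowering the reservations of a feasible triple to `WL` and moving the difference into the
shared capacity gives a feasible pair. -/
theorem Feasible7.feasible10 {N : ℕ} {W : ℕ → Fin N → ℝ} {PH : Fin N → ℝ} {F : Fin N → ℝ → ℝ}
    (hF : ∀ i x, Tendsto
      (fun T : ℕ => (1 / (T : ℝ)) * ∑ t ∈ Finset.Icc 1 T, ind (W t i ≤ x)) atTop (nhds (F i x)))
    {WL : Fin N → ℝ} {Wc : ℝ} {Wr : Fin N → ℝ} {u : ℕ → Fin N → ℝ}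
    (h : Feasible7 W PH F WL Wc Wr u) :
    Feasible10 W PH F WL (Wc + ∑ i, (Wr i - WL i)) (servedUpTo W Wr u) := by
  obtain ⟨hlim, hle, hcap, hu⟩ := h
  refine ⟨fun i => ?_, fun t => ?_, fun t i => ?_⟩
  · have hmem : ∀ t, u t i * ind (Wr i < W t i) ∈ Set.Icc (0 : ℝ) 1 := fun t => by
      unfold ind
      rcases hu t i with h | h <;> split_ifs <;> simp [h]
    have key := liminf_add_le_liminf_add_of_tendsto (average_mem_Icc hmem)
      ((hF i (Wr i)).sub (hF i (WL i)))
    have heq : (fun T : ℕ => (1 / (T : ℝ)) *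
          ∑ t ∈ Finset.Icc 1 T, servedUpTo W Wr u t i * ind (WL i < W t i)) =
        (fun T : ℕ => (1 / (T : ℝ)) * ∑ t ∈ Finset.Icc 1 T, u t i * ind (Wr i < W t i)) +
        fun T : ℕ => (1 / (T : ℝ)) * ∑ t ∈ Finset.Icc 1 T, ind (W t i ≤ Wr i) -
          (1 / (T : ℝ)) * ∑ t ∈ Finset.Icc 1 T, ind (W t i ≤ WL i) := by
      funext T
      simp only [servedUpTo_mul_ind W u _ (hle i), Pi.add_apply, Finset.sum_add_distrib,
        Finset.sum_sub_distrib]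
      ring
    rw [heq]
    linarith [hlim i]
  · have hsum := Finset.sum_le_sum fun i (_ : i ∈ Finset.univ) =>
      servedUpTo_mul_pos_le W (u := u) (t := t)
        (by rcases hu t i with h | h <;> simp [h]) (hle i)
    simp only [Finset.sum_add_distrib, Finset.sum_sub_distrib] at hsum ⊢
    linarith [hcap t]
  · unfold servedUpTo
    split_ifs
    exacts [Or.inr rfl, hu t i]

/-- Proposition 2, second statement (deterministic sample-path version). -/
theorem proposition2_second {N : ℕ} (W : ℕ → Fin N → ℝ) (PH PL : Fin N → ℝ) (F : Fin N → ℝ → ℝ)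
    (hF : ∀ i x, Filter.Tendsto
      (fun T : ℕ => (1 / (T : ℝ)) * ∑ t ∈ Finset.Icc 1 T, ind (W t i ≤ x))
      Filter.atTop (nhds (F i x)))
    (WL : Fin N → ℝ) (hWL : ∀ i, PL i ≤ F i (WL i))
    (Wc : ℝ) (u : ℕ → Fin N → ℝ)
    (hopt : Optimal10 W PH F WL Wc u) :
    Optimal7 W PH F WL Wc WL u := by
  obtain ⟨⟨hlim, hcap, hu⟩, hmin⟩ := hopt
  refine ⟨⟨hlim, fun _ => le_rfl, hcap, hu⟩, fun Wc' Wr' u' h => ?_⟩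
  have hle := hmin _ _ (h.feasible10 hF)
  rw [Finset.sum_sub_distrib] at hle
  unfold objective7
  linarith
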